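/- Let n > 4 and let G be a group of order 2ⁿ having a cyclic normal subgroup of order 2^{n-2} but no element of order 2^{n-1}. Then G has a non-inner class preserving automorphism (Aut_c(G) ≠ Inn(G)) if and only if G is isomorphic to G₁ or to G₂, where (with m = n + 2 so that the groups have order 2^{m-2+2} = 2ⁿ, i.e., writing the presentations with parameter m where 2^{m-2} is the order of x times 4): G₁ = ⟨x, y, z | x^{2^{n-2}} = y² = z² = 1, yxy = x^{1+2^{n-3}}, zyz = y, zxz = x^{-1+2^{n-3}}⟩ and G₂ = ⟨x, y, z | x^{2^{n-2}} = y² = z² = 1, yxy = x^{1+2^{n-3}}, zxz = x^{-1+2^{n-3}}, zyz = y x^{2^{n-3}}⟩. -/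

import Mathlib

/-- The subgroup of `MulAut G` consisting of class preserving automorphisms. -/
def classPreservingAuts (G : Type*) [Group G] : Subgroup (MulAut G) where
  carrier := {α | ∀ x : G, IsConj x (α x)}
  one_mem' := fun x => by simpa using IsConj.refl x
  mul_mem' := fun {a b} ha hb x => (hb x).trans (ha (b x))
  inv_mem' := fun {a} ha x => by
    have h := (ha (a⁻¹ x)).symm
    simpa using h

/-- The subgroup of inner automorphisms of `G`. -/
def innerAuts (G : Type*) [Group G] : Subgroup (MulAut G) :=
  (MulAut.conj : G →* MulAut G).range

/-- Relations for the group
`G₁ = ⟨x, y, z | x^{2^{n-2}} = y² = z² = 1, yxy = x^{1+2^{n-3}}, zyz = y,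
zxz = x^{-1+2^{n-3}}⟩`.  The generators `x, y, z` are indexed by `0, 1, 2`. -/
def relsG1 (n : ℕ) : Set (FreeGroup (Fin 3)) :=
  {(FreeGroup.of 0) ^ (2 ^ (n - 2)), (FreeGroup.of 1) ^ 2, (FreeGroup.of 2) ^ 2,
   (FreeGroup.of 1 * FreeGroup.of 0 * FreeGroup.of 1) *
     ((FreeGroup.of 0) ^ (1 + 2 ^ (n - 3)))⁻¹,
   (FreeGroup.of 2 * FreeGroup.of 1 * FreeGroup.of 2) * (FreeGroup.of 1)⁻¹,
   (FreeGroup.of 2 * FreeGroup.of 0 * FreeGroup.of 2) *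
     ((FreeGroup.of 0) ^ ((2 ^ (n - 3) : ℤ) - 1))⁻¹}

/-- Relations for the group
`G₂ = ⟨x, y, z | x^{2^{n-2}} = y² = z² = 1, yxy = x^{1+2^{n-3}},
zxz = x^{-1+2^{n-3}}, zyz = y x^{2^{n-3}}⟩`. -/
def relsG2 (n : ℕ) : Set (FreeGroup (Fin 3)) :=
  {(FreeGroup.of 0) ^ (2 ^ (n - 2)), (FreeGroup.of 1) ^ 2, (FreeGroup.of 2) ^ 2,
   (FreeGroup.of 1 * FreeGroup.of 0 * FreeGroup.of 1) *
     ((FreeGroup.of 0) ^ (1 + 2 ^ (n - 3)))⁻¹,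
   (FreeGroup.of 2 * FreeGroup.of 0 * FreeGroup.of 2) *
     ((FreeGroup.of 0) ^ ((2 ^ (n - 3) : ℤ) - 1))⁻¹,
   (FreeGroup.of 2 * FreeGroup.of 1 * FreeGroup.of 2) *
     (FreeGroup.of 1 * (FreeGroup.of 0) ^ (2 ^ (n - 3)))⁻¹}

namespace CyclicNormalSubgroup

section ClassPreserving

variable {G : Type*} [Group G]

theorem innerAuts_le_classPreservingAuts : innerAuts G ≤ classPreservingAuts G := by
  rintro _ ⟨g, rfl⟩ x
  exact isConj_iff.2 ⟨g, rfl⟩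

theorem conj_mem_innerAuts (g : G) : MulAut.conj g ∈ innerAuts G := ⟨g, rfl⟩

theorem exists_eq_conj {α : MulAut G} (hα : α ∈ classPreservingAuts G) (x : G) :
    ∃ g : G, α x = g * x * g⁻¹ := by
  obtain ⟨g, hg⟩ := isConj_iff.1 (hα x)
  exact ⟨g, hg.symm⟩

/-- An automorphism is inner as soon as its composition with an inner one is. -/
theorem mem_innerAuts_of_conj_mul {α : MulAut G} (g : G)
    (h : MulAut.conj g * α ∈ innerAuts G) : α ∈ innerAuts G :=
  ((innerAuts G).mul_mem_cancel_left (conj_mem_innerAuts g)).1 h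

theorem classPreservingAuts_eq_innerAuts_of_comm (h : ∀ a b : G, a * b = b * a) :
    classPreservingAuts G = innerAuts G := by
  refine le_antisymm (fun α hα => ?_) innerAuts_le_classPreservingAuts
  refine ⟨1, MulEquiv.ext fun x => ?_⟩
  obtain ⟨g, hg⟩ := exists_eq_conj hα x
  simp [hg, h g x]

theorem mem_innerAuts_of_fixes_index_two {A : Subgroup G} {t : G} (ht : t ∉ A)
    (hA : ∀ a ∈ A, ∀ b ∈ A, a * b = b * a) (hi : A.index = 2)
    {α : MulAut G} (hα : α ∈ classPreservingAuts G) (hfix : ∀ a ∈ A, α a = a) :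
    α ∈ innerAuts G := by
  have hcov : ∀ g : G, g ∉ A → g * t⁻¹ ∈ A := fun g hg => by
    rw [Subgroup.mul_mem_iff_of_index_two hi, inv_mem_iff]
    exact iff_of_false hg ht
  obtain ⟨a, ha, hat⟩ : ∃ a ∈ A, α t = a * t * a⁻¹ := by
    obtain ⟨g, hg⟩ := exists_eq_conj hα t
    by_cases h : g ∈ A
    · exact ⟨g, h, hg⟩
    · exact ⟨g * t⁻¹, hcov g h, by rw [hg]; group⟩
  have hA' : ∀ b ∈ A, α b = a * b * a⁻¹ := fun b hb => by
    rw [hfix b hb, hA a ha b hb, mul_inv_cancel_right]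
  refine ⟨a, MulEquiv.ext fun g => ?_⟩
  rw [MulAut.conj_apply]
  by_cases h : g ∈ A
  · exact (hA' g h).symm
  · have : α g = α (g * t⁻¹) * α t := by rw [← map_mul, inv_mul_cancel_right]
    rw [this, hA' _ (hcov g h), hat]
    group

theorem classPreservingAuts_eq_innerAuts_of_index_two (A : Subgroup G)
    (hA : ∀ a ∈ A, ∀ b ∈ A, a * b = b * a) (hi : A.index = 2) :
    classPreservingAuts G = innerAuts G := by
  refine le_antisymm (fun α hα => ?_) innerAuts_le_classPreservingAuts
  obtain ⟨t, ht⟩ : ∃ t, t ∉ A := by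
    by_contra! h
    rw [(Subgroup.eq_top_iff' A).2 h, Subgroup.index_top] at hi
    omega
  have hnorm : A.Normal := Subgroup.normal_of_index_eq_two hi
  have hdich : ∀ a ∈ A, α a = a ∨ α a = t * a * t⁻¹ := fun a ha => by
    obtain ⟨g, hg⟩ := exists_eq_conj hα a
    by_cases h : g ∈ A
    · left
      rw [hg, hA g h a ha, mul_inv_cancel_right]
    · right
      have hb : g * t⁻¹ ∈ A := by
        rw [Subgroup.mul_mem_iff_of_index_two hi, inv_mem_iff]
        exact iff_of_false h ht
      have : g * a * g⁻¹ = (g * t⁻¹) * (t * a * t⁻¹) * (g * t⁻¹)⁻¹ := by group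
      rw [hg, this, hA _ hb _ (hnorm.conj_mem a ha t), mul_inv_cancel_right]
  by_cases hfix : ∀ a ∈ A, α a = a
  · exact mem_innerAuts_of_fixes_index_two ht hA hi hα hfix
  · push Not at hfix
    obtain ⟨a, ha, hne⟩ := hfix
    have haa := (hdich a ha).resolve_left hne
    have hall : ∀ b ∈ A, α b = t * b * t⁻¹ := fun b hb => by
      rcases hdich b hb with hbb | hbb
      · rcases hdich (a * b) (mul_mem ha hb) with h | h
        · rw [map_mul, hbb] at h
          exact absurd (mul_right_cancel h) hne
        · have h' : α b = (α a)⁻¹ * α (a * b) := by rw [map_mul, inv_mul_cancel_left]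
          rw [h', h, haa]
          group
      · exact hbb
    refine mem_innerAuts_of_conj_mul t⁻¹ (mem_innerAuts_of_fixes_index_two ht hA hi
      (mul_mem (innerAuts_le_classPreservingAuts (conj_mem_innerAuts _)) hα) fun b hb => ?_)
    rw [MulAut.mul_apply, MulAut.conj_apply, hall b hb]
    group

/-- If `⟨x⟩` is normal with cyclic quotient generated by the image of `t`, then class preserving
automorphisms are inner. -/
theorem classPreservingAuts_eq_innerAuts_of_cyclic_quotient (x t : G)
    (hcov : ∀ g : G, ∃ i j : ℤ, g = x ^ i * t ^ j) :
    classPreservingAuts G = innerAuts G := by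
  refine le_antisymm (fun α hα => ?_) innerAuts_le_classPreservingAuts
  obtain ⟨g, hg⟩ := exists_eq_conj hα x
  refine mem_innerAuts_of_conj_mul g⁻¹ ?_
  have hβ : MulAut.conj g⁻¹ * α ∈ classPreservingAuts G :=
    mul_mem (innerAuts_le_classPreservingAuts (conj_mem_innerAuts _)) hα
  have hx : (MulAut.conj g⁻¹ * α) x = x := by
    rw [MulAut.mul_apply, MulAut.conj_apply, hg]
    group
  generalize MulAut.conj g⁻¹ * α = β at hβ hx
  obtain ⟨k, hk⟩ := exists_eq_conj hβ t
  obtain ⟨i, j, rfl⟩ := hcov k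
  have ht : β t = x ^ i * t * (x ^ i)⁻¹ := by
    rw [hk]
    group
  refine ⟨x ^ i, MulEquiv.ext fun l => ?_⟩
  obtain ⟨p, q, rfl⟩ := hcov l
  rw [MulAut.conj_apply, map_mul, map_zpow, map_zpow, hx, ht, conj_zpow]
  group

end ClassPreserving

section Powers

variable {G : Type*} [Group G]

theorem zpow_eq_zpow_of_dvd {x : G} {N : ℕ} (hx : x ^ N = 1) {i j : ℤ} (h : (N : ℤ) ∣ i - j) :
    x ^ i = x ^ j := by
  obtain ⟨k, hk⟩ := h
  rw [show i = j + N * k by linarith, zpow_add, zpow_mul, zpow_natCast, hx, one_zpow, mul_one]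

theorem dvd_of_zpow_eq_zpow {x : G} {N : ℕ} (hx : orderOf x = N) {i j : ℤ} (h : x ^ i = x ^ j) :
    (N : ℤ) ∣ i - j := by
  rw [← hx, orderOf_dvd_iff_zpow_eq_one, zpow_sub, h, mul_inv_cancel]

theorem mul_zpow_eq_of_conj {g x : G} {s : ℤ} (h : g * x * g⁻¹ = x ^ s) (i : ℤ) :
    g * x ^ i = x ^ (s * i) * g := by
  rw [zpow_mul, ← h, conj_zpow, inv_mul_cancel_right]

theorem inv_eq_self_of_sq {y : G} (h : y ^ 2 = 1) : y⁻¹ = y :=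
  inv_eq_of_mul_eq_one_right (by rw [← sq, h])

end Powers

section Triple

/-- Generators `x, y, z` satisfying the defining relations of `G₁` (for `e = 0`) or of `G₂`
(for `e = 1`), where `8 * M` stands for `2 ^ (n - 2)`. -/
structure IsTriple {G : Type*} [Group G] (M e : ℕ) (x y z : G) : Prop where
  x_pow : x ^ (8 * M) = 1
  y_sq : y ^ 2 = 1
  z_sq : z ^ 2 = 1
  conj_y : y * x * y⁻¹ = x ^ (4 * M + 1 : ℤ)
  conj_z : z * x * z⁻¹ = x ^ (4 * M - 1 : ℤ)
  z_mul_y : z * y = y * x ^ (4 * M * e : ℤ) * z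
  closure_eq : Subgroup.closure {x, y, z} = ⊤

variable {G : Type*} [Group G] {M e : ℕ} {x y z : G}

namespace IsTriple

theorem y_mul_y (h : IsTriple M e x y z) : y * y = 1 := by rw [← sq, h.y_sq]

theorem z_mul_z (h : IsTriple M e x y z) : z * z = 1 := by rw [← sq, h.z_sq]

theorem y_mul_x (h : IsTriple M e x y z) (i : ℤ) :
    y * x ^ i = x ^ ((4 * M + 1) * i) * y := mul_zpow_eq_of_conj h.conj_y i

theorem z_mul_x (h : IsTriple M e x y z) (i : ℤ) :
    z * x ^ i = x ^ ((4 * M - 1) * i) * z := mul_zpow_eq_of_conj h.conj_z i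

theorem zpow_eq (h : IsTriple M e x y z) {i j : ℤ} (hd : (8 * M : ℤ) ∣ i - j) : x ^ i = x ^ j :=
  zpow_eq_zpow_of_dvd h.x_pow (by exact_mod_cast hd)

theorem exists_normal_form (h : IsTriple M e x y z) (g : G) :
    ∃ i : ℤ, g = x ^ i ∨ g = x ^ i * y ∨ g = x ^ i * z ∨ g = x ^ i * y * z := by
  have hg : g ∈ Subgroup.closure {x, y, z} := by rw [h.closure_eq]; trivial
  have key_x : ∀ (a : ℤ) (g : G),
      (∃ i : ℤ, g = x ^ i ∨ g = x ^ i * y ∨ g = x ^ i * z ∨ g = x ^ i * y * z) →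
      ∃ i : ℤ, x ^ a * g = x ^ i ∨ x ^ a * g = x ^ i * y ∨ x ^ a * g = x ^ i * z ∨
        x ^ a * g = x ^ i * y * z := by
    rintro a g ⟨i, hi⟩
    refine ⟨a + i, ?_⟩
    rcases hi with rfl | rfl | rfl | rfl <;> simp [zpow_add, mul_assoc]
  have key_y : ∀ g : G,
      (∃ i : ℤ, g = x ^ i ∨ g = x ^ i * y ∨ g = x ^ i * z ∨ g = x ^ i * y * z) →
      ∃ i : ℤ, y * g = x ^ i ∨ y * g = x ^ i * y ∨ y * g = x ^ i * z ∨
        y * g = x ^ i * y * z := by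
    rintro g ⟨i, hi⟩
    refine ⟨(4 * M + 1) * i, ?_⟩
    rcases hi with rfl | rfl | rfl | rfl <;>
      simp [← mul_assoc, h.y_mul_x] <;> simp [mul_assoc, h.y_mul_y]
  have key_z : ∀ g : G,
      (∃ i : ℤ, g = x ^ i ∨ g = x ^ i * y ∨ g = x ^ i * z ∨ g = x ^ i * y * z) →
      ∃ i : ℤ, z * g = x ^ i ∨ z * g = x ^ i * y ∨ z * g = x ^ i * z ∨
        z * g = x ^ i * y * z := by
    rintro g ⟨i, hi⟩
    have hzy : ∀ i : ℤ, z * (x ^ i * y) =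
        x ^ ((4 * M - 1) * i + (4 * M + 1) * (4 * M * e)) * y * z := fun i => by
      rw [← mul_assoc, h.z_mul_x, mul_assoc, h.z_mul_y, h.y_mul_x, zpow_add]
      simp only [mul_assoc]
    rcases hi with rfl | rfl | rfl | rfl
    · exact ⟨(4 * M - 1) * i, Or.inr (Or.inr (Or.inl (h.z_mul_x i)))⟩
    · exact ⟨_, Or.inr (Or.inr (Or.inr (hzy i)))⟩
    · refine ⟨(4 * M - 1) * i, Or.inl ?_⟩
      rw [← mul_assoc, h.z_mul_x, mul_assoc, h.z_mul_z, mul_one]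
    · refine ⟨(4 * M - 1) * i + (4 * M + 1) * (4 * M * e), Or.inr (Or.inl ?_)⟩
      rw [← mul_assoc, hzy, mul_assoc, h.z_mul_z, mul_one]
  induction hg using Subgroup.closure_induction_left with
  | one => exact ⟨0, Or.inl (zpow_zero x).symm⟩
  | mul_left s hs g _ ih =>
    rcases hs with rfl | rfl | rfl
    · simpa using key_x 1 g ih
    · exact key_y g ih
    · exact key_z g ih
  | inv_mul_cancel s hs g _ ih =>
    rcases hs with rfl | rfl | rfl
    · simpa using key_x (-1) g ih
    · rw [inv_eq_self_of_sq h.y_sq]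
      exact key_y g ih
    · rw [inv_eq_self_of_sq h.z_sq]
      exact key_z g ih

theorem finite_and_card_le (h : IsTriple M e x y z) (hM : 0 < M) :
    Finite G ∧ Nat.card G ≤ orderOf x * 4 := by
  have hfx : IsOfFinOrder x := isOfFinOrder_iff_pow_eq_one.2 ⟨8 * M, by omega, h.x_pow⟩
  have : Finite (Subgroup.zpowers x) := finite_zpowers.2 hfx
  let f : Subgroup.zpowers x × Bool × Bool → G := fun p =>
    (p.1 : G) * (if p.2.1 then y else 1) * (if p.2.2 then z else 1)
  have hf : Function.Surjective f := fun g => by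
    obtain ⟨i, rfl | rfl | rfl | rfl⟩ := h.exists_normal_form g
    · exact ⟨(⟨x ^ i, i, rfl⟩, false, false), by simp [f]⟩
    · exact ⟨(⟨x ^ i, i, rfl⟩, true, false), by simp [f]⟩
    · exact ⟨(⟨x ^ i, i, rfl⟩, false, true), by simp [f]⟩
    · exact ⟨(⟨x ^ i, i, rfl⟩, true, true), by simp [f]⟩
  refine ⟨Finite.of_surjective f hf, (Nat.card_le_card_of_surjective f hf).trans ?_⟩
  simp [Nat.card_prod, Nat.card_zpowers]

theorem orderOf_x (h : IsTriple M e x y z) (hM : 0 < M) (hcard : Nat.card G = 32 * M) :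
    orderOf x = 8 * M := by
  have h1 := (h.finite_and_card_le hM).2
  have h2 := Nat.le_of_dvd (by omega) (orderOf_dvd_of_pow_eq_one h.x_pow)
  omega

theorem x_half_mem_center (h : IsTriple M e x y z) (g : G) :
    g * x ^ (4 * M : ℤ) = x ^ (4 * M : ℤ) * g := by
  have hx : ∀ i : ℤ, x ^ i * x ^ (4 * M : ℤ) = x ^ (4 * M : ℤ) * x ^ i := fun i => by
    rw [← zpow_add, ← zpow_add, add_comm]
  have hy : y * x ^ (4 * M : ℤ) = x ^ (4 * M : ℤ) * y := by
    rw [h.y_mul_x, h.zpow_eq (j := 4 * M) ⟨2 * M, by ring⟩]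
  have hz : z * x ^ (4 * M : ℤ) = x ^ (4 * M : ℤ) * z := by
    rw [h.z_mul_x, h.zpow_eq (j := 4 * M) ⟨2 * M - 1, by ring⟩]
  obtain ⟨i, rfl | rfl | rfl | rfl⟩ := h.exists_normal_form g
  · exact hx i
  · rw [mul_assoc, hy, ← mul_assoc, hx, mul_assoc]
  · rw [mul_assoc, hz, ← mul_assoc, hx, mul_assoc]
  · rw [mul_assoc, hz, ← mul_assoc, mul_assoc (x ^ i), hy, ← mul_assoc, hx]
    simp only [mul_assoc]

/-- The generator `y` is conjugate to `y * c` via `x`, where `c` is the central involution in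
`⟨x⟩`. -/
theorem x_inv_mul_y_mul_x (h : IsTriple M e x y z) :
    x⁻¹ * y * x = y * x ^ (4 * M : ℤ) := by
  have h1 := h.y_mul_x 1
  rw [zpow_one, mul_one] at h1
  rw [mul_assoc, h1, ← mul_assoc, h.x_half_mem_center, zpow_add, zpow_one]
  simp only [← mul_assoc]
  rw [mul_assoc x⁻¹, ← h.x_half_mem_center x, inv_mul_cancel_left]

theorem mem_zpowers_of_commute (h : IsTriple M e x y z) (hM : 0 < M) (hord : orderOf x = 8 * M)
    {g : G} (hg : g * x = x * g) : ∃ i : ℤ, x ^ i = g := by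
  have hM' : (0 : ℤ) < M := by exact_mod_cast hM
  have hdvd : ∀ i s : ℤ, ∀ w : G, w * x = x ^ s * w → x ^ i * w * x = x * (x ^ i * w) →
      (8 * M : ℤ) ∣ s - 1 := fun i s w hw hc => by
    rw [mul_assoc, hw, ← mul_assoc, ← mul_assoc, mul_left_inj, ← zpow_add, ← zpow_one_add,
      add_comm, add_comm 1 i] at hc
    have := dvd_of_zpow_eq_zpow hord hc
    push_cast at this
    convert this using 1
    ring
  have hyx : y * x = x ^ (4 * M + 1 : ℤ) * y := by simpa using h.y_mul_x 1
  have hzx : z * x = x ^ (4 * M - 1 : ℤ) * z := by simpa using h.z_mul_x 1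
  have hyzx : y * z * x = x ^ ((4 * M + 1) * (4 * M - 1) : ℤ) * (y * z) := by
    rw [mul_assoc, hzx, ← mul_assoc, h.y_mul_x, mul_assoc]
  obtain ⟨i, rfl | rfl | rfl | rfl⟩ := h.exists_normal_form g
  · exact ⟨i, rfl⟩
  · obtain ⟨k, hk⟩ := hdvd i _ y hyx hg
    have : (2 * k - 1) * (4 * (M : ℤ)) = 0 := by linarith
    rcases mul_eq_zero.1 this with h2 | h2 <;> omega
  · obtain ⟨k, hk⟩ := hdvd i _ z hzx hg
    have : 4 * ((2 * k - 1) * (M : ℤ)) = -2 := by linarith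
    omega
  · obtain ⟨k, hk⟩ := hdvd i _ (y * z) hyzx (by rw [← mul_assoc, hg])
    have : 4 * (2 * M * k - 4 * M ^ 2 : ℤ) = -2 := by linarith
    omega

theorem classPreservingAuts_ne_innerAuts (h : IsTriple M e x y z) (hM : 0 < M)
    (hcard : Nat.card G = 32 * M) (χ : G →* ℤˣ) (hx : χ x = 1) (hy : χ y = -1) (hz : χ z = 1) :
    classPreservingAuts G ≠ innerAuts G := by
  have hord : orderOf x = 8 * M := h.orderOf_x hM hcard
  have hM' : (0 : ℤ) < M := by exact_mod_cast hM
  have hdvd : ∀ i j : ℤ, x ^ i = x ^ j → (8 * M : ℤ) ∣ i - j := fun i j hij => by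
    exact_mod_cast dvd_of_zpow_eq_zpow hord hij
  set c : G := x ^ (4 * M : ℤ) with hc
  have hcen : ∀ g : G, g * c = c * g := h.x_half_mem_center
  have hcc : c * c = 1 := by
    rw [hc, ← zpow_add, ← zpow_zero x]
    exact h.zpow_eq ⟨1, by ring⟩
  have hχc : χ c = 1 := by rw [hc, map_zpow, hx, one_zpow]
  have hc1 : c ≠ 1 := fun h1 => by
    rw [hc, ← zpow_zero x] at h1
    obtain ⟨k, hk⟩ := hdvd _ _ h1
    have : (2 * k - 1) * (4 * (M : ℤ)) = 0 := by linarith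
    rcases mul_eq_zero.1 this with h2 | h2 <;> omega
  let f : G → G := fun g => if χ g = 1 then g else g * c
  have hf1 : ∀ g, χ g = 1 → f g = g := fun g hg => if_pos hg
  have hf2 : ∀ g, χ g = -1 → f g = g * c := fun g hg => if_neg (by rw [hg]; decide)
  have hmul : ∀ a b, f (a * b) = f a * f b := fun a b => by
    rcases Int.units_eq_one_or (χ a) with ha | ha <;>
      rcases Int.units_eq_one_or (χ b) with hb | hb
    · rw [hf1 _ ha, hf1 _ hb, hf1 _ (by rw [map_mul, ha, hb, one_mul])]
    · rw [hf1 _ ha, hf2 _ hb, hf2 _ (by rw [map_mul, ha, hb, one_mul]), mul_assoc]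
    · rw [hf2 _ ha, hf1 _ hb, hf2 _ (by rw [map_mul, ha, hb, mul_one]), mul_assoc, mul_assoc,
        hcen b]
    · rw [hf2 _ ha, hf2 _ hb, hf1 _ (by rw [map_mul, ha, hb]; decide), mul_assoc a c,
        ← mul_assoc c b c, ← hcen b, mul_assoc b c c, hcc, mul_one]
  have hinv : Function.Involutive f := fun g => by
    rcases Int.units_eq_one_or (χ g) with hg | hg
    · rw [hf1 g hg, hf1 g hg]
    · rw [hf2 g hg, hf2 _ (by rw [map_mul, hg, hχc, mul_one]), mul_assoc, hcc, mul_one]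
  let α : MulAut G := { hinv.toPerm with map_mul' := hmul }
  have hα : ∀ g, α g = f g := fun _ => rfl
  intro heq
  have hαc : α ∈ classPreservingAuts G := fun g => by
    rw [hα]
    rcases Int.units_eq_one_or (χ g) with hg | hg
    · rw [hf1 g hg]
    · rw [hf2 g hg]
      obtain ⟨i, rfl | rfl | rfl | rfl⟩ := h.exists_normal_form g
      · simp [hx] at hg
      · refine isConj_iff.2 ⟨x⁻¹, ?_⟩
        calc x⁻¹ * (x ^ i * y) * x⁻¹⁻¹ = x ^ i * (x⁻¹ * y * x) := by group
          _ = x ^ i * y * c := by rw [h.x_inv_mul_y_mul_x, mul_assoc]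
      · simp [hx, hz] at hg
      · refine isConj_iff.2 ⟨x ^ (2 * M : ℤ), ?_⟩
        have e1 : y * z * x ^ (-(2 * M) : ℤ) = x ^ (2 * M : ℤ) * y * z := by
          rw [mul_assoc, h.z_mul_x, ← mul_assoc, h.y_mul_x]
          congr 2
          exact h.zpow_eq ⟨-4 * M ^ 2, by ring⟩
        calc x ^ (2 * M : ℤ) * (x ^ i * y * z) * (x ^ (2 * M : ℤ))⁻¹
            = x ^ (2 * M : ℤ) * x ^ i * (y * z * x ^ (-(2 * M) : ℤ)) := by
              rw [zpow_neg]; group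
          _ = x ^ (2 * M + i + 2 * M : ℤ) * y * z := by
              rw [e1, zpow_add, zpow_add]; simp only [mul_assoc]
          _ = c * (x ^ i * y * z) := by
              rw [show (2 * M + i + 2 * M : ℤ) = 4 * M + i by ring, zpow_add]
              simp only [mul_assoc, hc]
          _ = x ^ i * y * z * c := (hcen _).symm
  rw [heq] at hαc
  obtain ⟨g, hg⟩ := hαc
  have hgα : ∀ a, g * a = f a * g := fun a => by
    rw [← hα, ← hg, MulAut.conj_apply, inv_mul_cancel_right]
  have hgx := hgα x
  have hgy := hgα y
  have hgz := hgα z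
  rw [hf1 x hx] at hgx
  rw [hf2 y hy] at hgy
  rw [hf1 z hz] at hgz
  obtain ⟨i, rfl⟩ := h.mem_zpowers_of_commute hM hord hgx
  rw [h.z_mul_x, mul_left_inj] at hgz
  obtain ⟨k, hk⟩ := hdvd _ _ hgz
  have hi' : i = 2 * M * i + 4 * M * k := by linarith
  have hi : i = 4 * M * (M * i + 2 * M * k + k) := by linear_combination (1 + 2 * M) * hi'
  have hcomm : y * x ^ i = x ^ i * y := by
    rw [hi, zpow_mul]
    exact (Commute.zpow_right (hcen y) _).eq
  rw [hcen y, mul_assoc, hcomm] at hgy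
  exact hc1 (right_eq_mul.1 hgy)

end IsTriple

theorem classPreservingAuts_eq_innerAuts_of_mulEquiv {G' : Type*} [Group G'] (e : G ≃* G')
    (h : classPreservingAuts G = innerAuts G) : classPreservingAuts G' = innerAuts G' := by
  refine le_antisymm (fun α hα => ?_) innerAuts_le_classPreservingAuts
  have hβ : ((e.trans α).trans e.symm : MulAut G) ∈ classPreservingAuts G := fun x => by
    simpa using e.symm.toMonoidHom.map_isConj (hα (e x))
  rw [h] at hβ
  obtain ⟨g, hg⟩ := hβ
  refine ⟨e g, MulEquiv.ext fun x => ?_⟩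
  have := congrArg e (DFunLike.congr_fun hg (e.symm x))
  simpa using this

end Triple

section Presentation

variable {G : Type*} [Group G] {k e : ℕ} {x y z : G}

theorem isTriple_of_relations (hx : x ^ 2 ^ (k + 3) = 1) (hy : y ^ 2 = 1) (hz : z ^ 2 = 1)
    (hyx : y * x * y = x ^ (1 + 2 ^ (k + 2))) (hzx : z * x * z = x ^ ((2 ^ (k + 2) : ℤ) - 1))
    (hzy : z * y * z = y * (x ^ 2 ^ (k + 2)) ^ e) (hgen : Subgroup.closure {x, y, z} = ⊤) :
    IsTriple (2 ^ k) e x y z where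
  x_pow := by rw [← hx]; congr 1; ring
  y_sq := hy
  z_sq := hz
  conj_y := by
    rw [inv_eq_self_of_sq hy, hyx, ← zpow_natCast]
    congr 1; push_cast; ring
  conj_z := by
    rw [inv_eq_self_of_sq hz, hzx]
    congr 1; push_cast; ring
  z_mul_y := by
    have : (4 * (2 ^ k : ℕ) * e : ℤ) = (2 ^ (k + 2) * e : ℕ) := by push_cast; ring
    rw [this, zpow_natCast, pow_mul, ← hzy, mul_assoc (z * y), ← sq, hz, mul_one]
  closure_eq := hgen

theorem IsTriple.y_mul_x_mul_y (h : IsTriple (2 ^ k) e x y z) :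
    y * x * y = x ^ (1 + 2 ^ (k + 2)) := by
  have := h.conj_y
  rw [inv_eq_self_of_sq h.y_sq] at this
  rw [this, ← zpow_natCast]
  congr 1; push_cast; ring

theorem IsTriple.z_mul_x_mul_z (h : IsTriple (2 ^ k) e x y z) :
    z * x * z = x ^ ((2 ^ (k + 2) : ℤ) - 1) := by
  have := h.conj_z
  rw [inv_eq_self_of_sq h.z_sq] at this
  rw [this]
  congr 1; push_cast; ring

theorem IsTriple.z_mul_y_mul_z (h : IsTriple (2 ^ k) e x y z) :
    z * y * z = y * (x ^ 2 ^ (k + 2)) ^ e := by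
  have : (4 * (2 ^ k : ℕ) * e : ℤ) = (2 ^ (k + 2) * e : ℕ) := by push_cast; ring
  rw [h.z_mul_y, mul_assoc, h.z_mul_z, mul_one, this, zpow_natCast, pow_mul]

theorem IsTriple.x_pow_two_pow (h : IsTriple (2 ^ k) e x y z) : x ^ 2 ^ (k + 3) = 1 := by
  rw [← h.x_pow]
  congr 1; ring

theorem closure_generators (rels : Set (FreeGroup (Fin 3))) :
    Subgroup.closure {PresentedGroup.of (rels := rels) 0, PresentedGroup.of 1,
      PresentedGroup.of 2} = ⊤ := by
  rw [← PresentedGroup.closure_range_of rels]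
  congr 1
  ext g
  simp [Fin.exists_fin_succ, eq_comm]

theorem isTriple_of_map_relsG1 {φ : FreeGroup (Fin 3) →* G} (h : ∀ r ∈ relsG1 (k + 5), φ r = 1)
    (hgen : Subgroup.closure {φ (.of 0), φ (.of 1), φ (.of 2)} = ⊤) :
    IsTriple (2 ^ k) 0 (φ (.of 0)) (φ (.of 1)) (φ (.of 2)) := by
  simp only [relsG1, Set.mem_insert_iff, Set.mem_singleton_iff, forall_eq_or_imp, forall_eq,
    map_mul, map_inv, map_pow, map_zpow, mul_inv_eq_one] at h
  obtain ⟨hx, hy, hz, hyx, hzy, hzx⟩ := h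
  exact isTriple_of_relations hx hy hz hyx hzx (by rw [pow_zero, mul_one]; exact hzy) hgen

theorem isTriple_relsG1 (k : ℕ) : IsTriple (2 ^ k) 0
    (PresentedGroup.of (rels := relsG1 (k + 5)) 0) (PresentedGroup.of 1)
    (PresentedGroup.of 2) :=
  isTriple_of_map_relsG1 (fun _ hr => PresentedGroup.one_of_mem hr) (closure_generators _)

theorem isTriple_of_map_relsG2 {φ : FreeGroup (Fin 3) →* G} (h : ∀ r ∈ relsG2 (k + 5), φ r = 1)
    (hgen : Subgroup.closure {φ (.of 0), φ (.of 1), φ (.of 2)} = ⊤) :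
    IsTriple (2 ^ k) 1 (φ (.of 0)) (φ (.of 1)) (φ (.of 2)) := by
  simp only [relsG2, Set.mem_insert_iff, Set.mem_singleton_iff, forall_eq_or_imp, forall_eq,
    map_mul, map_inv, map_pow, map_zpow, mul_inv_eq_one] at h
  obtain ⟨hx, hy, hz, hyx, hzx, hzy⟩ := h
  exact isTriple_of_relations hx hy hz hyx hzx (by rw [pow_one]; exact hzy) hgen

theorem isTriple_relsG2 (k : ℕ) : IsTriple (2 ^ k) 1
    (PresentedGroup.of (rels := relsG2 (k + 5)) 0) (PresentedGroup.of 1)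
    (PresentedGroup.of 2) :=
  isTriple_of_map_relsG2 (fun _ hr => PresentedGroup.one_of_mem hr) (closure_generators _)

theorem IsTriple.lift_relsG1 (h : IsTriple (2 ^ k) 0 x y z) :
    ∀ r ∈ relsG1 (k + 5), FreeGroup.lift ![x, y, z] r = 1 := by
  simp only [relsG1, Set.mem_insert_iff, Set.mem_singleton_iff, forall_eq_or_imp, forall_eq,
    map_mul, map_inv, map_pow, map_zpow, mul_inv_eq_one, FreeGroup.lift_apply_of]
  exact ⟨h.x_pow_two_pow, h.y_sq, h.z_sq, h.y_mul_x_mul_y,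
    by simpa using h.z_mul_y_mul_z, h.z_mul_x_mul_z⟩

theorem IsTriple.lift_relsG2 (h : IsTriple (2 ^ k) 1 x y z) :
    ∀ r ∈ relsG2 (k + 5), FreeGroup.lift ![x, y, z] r = 1 := by
  simp only [relsG2, Set.mem_insert_iff, Set.mem_singleton_iff, forall_eq_or_imp, forall_eq,
    map_mul, map_inv, map_pow, map_zpow, mul_inv_eq_one, FreeGroup.lift_apply_of]
  exact ⟨h.x_pow_two_pow, h.y_sq, h.z_sq, h.y_mul_x_mul_y, h.z_mul_x_mul_z,
    by simpa using h.z_mul_y_mul_z⟩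

theorem IsTriple.nonempty_mulEquiv {M : ℕ} {rels : Set (FreeGroup (Fin 3))} {e' : ℕ}
    (h : IsTriple M e x y z) (hM : 0 < M) (hcard : Nat.card G = 32 * M)
    (hP : IsTriple M e' (PresentedGroup.of (rels := rels) 0) (PresentedGroup.of 1)
      (PresentedGroup.of 2))
    (hl : ∀ r ∈ rels, FreeGroup.lift ![x, y, z] r = 1) :
    Nonempty (G ≃* PresentedGroup rels) := by
  let φ : PresentedGroup rels →* G := PresentedGroup.toGroup hl
  have hφ : ∀ i, φ (PresentedGroup.of i) = ![x, y, z] i := fun i => PresentedGroup.toGroup.of hl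
  have hsurj : Function.Surjective φ := by
    rw [← MonoidHom.range_eq_top, eq_top_iff, ← h.closure_eq, Subgroup.closure_le]
    rintro _ (rfl | rfl | rfl)
    exacts [⟨_, hφ 0⟩, ⟨_, hφ 1⟩, ⟨_, hφ 2⟩]
  obtain ⟨hfin, hle⟩ := hP.finite_and_card_le hM
  have hx := Nat.le_of_dvd (by omega) (orderOf_dvd_of_pow_eq_one hP.x_pow)
  exact ⟨(MulEquiv.ofBijective φ
    (hsurj.bijective_of_nat_card_le (by rw [hcard]; omega))).symm⟩

theorem IsTriple.classPreservingAuts_ne_innerAuts_of_mulEquiv {M : ℕ}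
    {rels : Set (FreeGroup (Fin 3))} (hM : 0 < M) (hcard : Nat.card G = 32 * M)
    (hP : IsTriple M e (PresentedGroup.of (rels := rels) 0) (PresentedGroup.of 1)
      (PresentedGroup.of 2))
    (hl : ∀ r ∈ rels, FreeGroup.lift ![1, (-1 : ℤˣ), 1] r = 1)
    (f : G ≃* PresentedGroup rels) : classPreservingAuts G ≠ innerAuts G := fun heq =>
  hP.classPreservingAuts_ne_innerAuts hM (by rw [← Nat.card_congr f.toEquiv, hcard])
    (PresentedGroup.toGroup hl) (PresentedGroup.toGroup.of hl) (PresentedGroup.toGroup.of hl)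
    (PresentedGroup.toGroup.of hl) (classPreservingAuts_eq_innerAuts_of_mulEquiv f heq)

theorem lift_sign_relsG1 (n : ℕ) :
    ∀ r ∈ relsG1 n, FreeGroup.lift ![1, (-1 : ℤˣ), 1] r = 1 := by
  simp [relsG1]

theorem lift_sign_relsG2 (n : ℕ) :
    ∀ r ∈ relsG2 n, FreeGroup.lift ![1, (-1 : ℤˣ), 1] r = 1 := by
  simp [relsG2]

end Presentation

section Structure

variable {G : Type*} [Group G]

theorem involutive_units_mod_two_pow {k : ℕ} {s : ℤ} (h : (8 * (2 ^ k : ℕ) : ℤ) ∣ s * s - 1) :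
    (8 * (2 ^ k : ℕ) : ℤ) ∣ s - 1 ∨ (8 * (2 ^ k : ℕ) : ℤ) ∣ s - -1 ∨
      (8 * (2 ^ k : ℕ) : ℤ) ∣ s - (4 * (2 ^ k : ℕ) + 1) ∨
      (8 * (2 ^ k : ℕ) : ℤ) ∣ s - (4 * (2 ^ k : ℕ) - 1) := by
  push_cast at h ⊢
  obtain ⟨c, hc⟩ := h
  obtain ⟨u, rfl⟩ : Odd s := by
    rw [← Int.not_even_iff_odd]
    rintro ⟨v, rfl⟩
    have : 2 * (2 * v * v - 4 * 2 ^ k * c) = 1 := by linear_combination hc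
    omega
  have hu : (2 : ℤ) ^ (k + 1) ∣ u * (u + 1) := ⟨c, by
    have : 4 * (u * (u + 1)) = 4 * (2 ^ (k + 1) * c) := by linear_combination hc
    linarith⟩
  have hcop : ∀ w : ℤ, IsCoprime ((2 : ℤ) ^ (k + 1)) (2 * w + 1) := fun w =>
    IsCoprime.pow_left ⟨-w, 1, by ring⟩
  rcases Int.even_or_odd' u with ⟨w, rfl | rfl⟩
  · obtain ⟨v, hv⟩ := (hcop w).dvd_of_dvd_mul_right hu
    rcases Int.even_or_odd' v with ⟨t, rfl | rfl⟩
    · exact Or.inl ⟨t, by linear_combination 2 * hv⟩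
    · exact Or.inr (Or.inr (Or.inl ⟨t, by linear_combination 2 * hv⟩))
  · obtain ⟨v, hv⟩ := (hcop w).dvd_of_dvd_mul_left hu
    rcases Int.even_or_odd' v with ⟨t, rfl | rfl⟩
    · exact Or.inr (Or.inl ⟨t, by linear_combination 2 * hv⟩)
    · exact Or.inr (Or.inr (Or.inr ⟨t, by linear_combination 2 * hv⟩))

/-- If `⟨x⟩` is self-centralizing of index four and `G / ⟨x⟩` has exponent two, then all four
involutive units modulo the order of `x` occur as conjugation actions on `x`. -/
theorem exists_conj_eq_of_self_centralizing {k : ℕ} {x : G} (hx : orderOf x = 8 * 2 ^ k)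
    (hn : (Subgroup.zpowers x).Normal) (hi : (Subgroup.zpowers x).index = 4)
    (hC : ∀ g : G, g * x = x * g → g ∈ Subgroup.zpowers x)
    (hsq : ∀ g : G, g * g ∈ Subgroup.zpowers x) :
    (∀ g : G, g * x * g⁻¹ = x ∨ g * x * g⁻¹ = x ^ (-1 : ℤ) ∨
      g * x * g⁻¹ = x ^ (4 * (2 ^ k : ℕ) + 1 : ℤ) ∨
      g * x * g⁻¹ = x ^ (4 * (2 ^ k : ℕ) - 1 : ℤ)) ∧
    (∃ y : G, y * x * y⁻¹ = x ^ (4 * (2 ^ k : ℕ) + 1 : ℤ)) ∧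
    ∃ z : G, z * x * z⁻¹ = x ^ (4 * (2 ^ k : ℕ) - 1 : ℤ) := by
  classical
  have hcases : ∀ g : G, g * x * g⁻¹ = x ∨ g * x * g⁻¹ = x ^ (-1 : ℤ) ∨
      g * x * g⁻¹ = x ^ (4 * (2 ^ k : ℕ) + 1 : ℤ) ∨
      g * x * g⁻¹ = x ^ (4 * (2 ^ k : ℕ) - 1 : ℤ) := fun g => by
    obtain ⟨s, hs⟩ := hn.conj_mem x (Subgroup.mem_zpowers x) g
    obtain ⟨j, hj⟩ := hsq g
    have hpow : x ^ (8 * 2 ^ k) = 1 := by rw [← hx, pow_orderOf_eq_one]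
    have hs' : g * x * g⁻¹ = x ^ s := hs.symm
    have hss : x ^ (s * s) = x ^ (1 : ℤ) := by
      rw [zpow_mul, ← hs', conj_zpow, ← hs',
        show g * (g * x * g⁻¹) * g⁻¹ = (g * g) * x * (g * g)⁻¹ by group, ← hj, zpow_one]
      group
    have hd := dvd_of_zpow_eq_zpow hx hss
    rw [hs']
    have key : ∀ t : ℤ, (8 * (2 ^ k : ℕ) : ℤ) ∣ s - t → x ^ s = x ^ t := fun t ht =>
      zpow_eq_zpow_of_dvd hpow (by exact_mod_cast ht)
    rcases involutive_units_mod_two_pow (by exact_mod_cast hd) with h | h | h | h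
    · exact Or.inl ((key 1 h).trans (zpow_one x))
    · exact Or.inr (Or.inl (key _ h))
    · exact Or.inr (Or.inr (Or.inl (key _ h)))
    · exact Or.inr (Or.inr (Or.inr (key _ h)))
  refine ⟨hcases, ?_⟩
  have hcard : Nat.card (G ⧸ Subgroup.zpowers x) = 4 := hi
  have : Finite (G ⧸ Subgroup.zpowers x) := Nat.finite_of_card_ne_zero (by omega)
  have := Fintype.ofFinite (G ⧸ Subgroup.zpowers x)
  let F : G ⧸ Subgroup.zpowers x → G := fun q => q.out * x * q.out⁻¹
  have hF : Function.Injective F := fun p q hpq => by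
    rw [← p.out_eq', ← q.out_eq']
    refine QuotientGroup.eq.2 (hC _ ?_)
    simp only [F] at hpq
    calc p.out⁻¹ * q.out * x = p.out⁻¹ * (q.out * x * q.out⁻¹) * q.out := by group
      _ = x * (p.out⁻¹ * q.out) := by rw [← hpq]; group
  let S : Finset G := {x, x ^ (-1 : ℤ), x ^ (4 * (2 ^ k : ℕ) + 1 : ℤ),
    x ^ (4 * (2 ^ k : ℕ) - 1 : ℤ)}
  have himg : Finset.univ.image F = S := by
    refine Finset.eq_of_subset_of_card_le (fun g hg => ?_) ?_
    · obtain ⟨q, -, rfl⟩ := Finset.mem_image.1 hg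
      simpa [S, F] using hcases q.out
    · rw [Finset.card_image_of_injective _ hF, Finset.card_univ, ← Nat.card_eq_fintype_card, hcard]
      exact Finset.card_le_four
  constructor
  · have : x ^ (4 * (2 ^ k : ℕ) + 1 : ℤ) ∈ Finset.univ.image F := by rw [himg]; simp [S]
    obtain ⟨q, -, hq⟩ := Finset.mem_image.1 this
    exact ⟨q.out, hq⟩
  · have : x ^ (4 * (2 ^ k : ℕ) - 1 : ℤ) ∈ Finset.univ.image F := by rw [himg]; simp [S]
    obtain ⟨q, -, hq⟩ := Finset.mem_image.1 this
    exact ⟨q.out, hq⟩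

theorem conj_zpow_mul {x y : G} {s : ℤ} (h : y * x * y⁻¹ = x ^ s) (a : ℤ) :
    (x ^ a * y) * x * (x ^ a * y)⁻¹ = x ^ s := by
  rw [show (x ^ a * y) * x * (x ^ a * y)⁻¹ = x ^ a * (y * x * y⁻¹) * (x ^ a)⁻¹ by group, h]
  group

theorem zpow_mul_sq {x y : G} {s : ℤ} (h : y * x * y⁻¹ = x ^ s) {i : ℤ} (hy : x ^ i = y * y)
    (a : ℤ) : (x ^ a * y) ^ 2 = x ^ (a + s * a + i) := by
  rw [sq, mul_assoc, ← mul_assoc y, mul_zpow_eq_of_conj h, mul_assoc, ← hy, ← mul_assoc, zpow_add,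
    zpow_add]

/-- An element acting on `⟨x⟩` as `x ↦ x ^ s` has its square in the fixed points of this action. -/
theorem dvd_of_zpow_eq_mul_self {x y : G} {s : ℤ} {N : ℕ} (hx : orderOf x = N)
    (h : y * x * y⁻¹ = x ^ s) {i : ℤ} (hy : x ^ i = y * y) : (N : ℤ) ∣ s * i - i := by
  refine dvd_of_zpow_eq_zpow hx ?_
  have := mul_zpow_eq_of_conj h i
  rw [hy, ← mul_assoc, mul_left_inj] at this
  rw [← this, hy]

theorem exists_involution_conj_add {M : ℕ} (hM : 0 < M) {x y : G} (hx : orderOf x = 8 * M)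
    (h : y * x * y⁻¹ = x ^ (4 * M + 1 : ℤ)) (hy : y * y ∈ Subgroup.zpowers x) :
    ∃ y' : G, y' * x * y'⁻¹ = x ^ (4 * M + 1 : ℤ) ∧ y' ^ 2 = 1 := by
  obtain ⟨i, hi⟩ := hy
  obtain ⟨c, hc⟩ := dvd_of_zpow_eq_mul_self hx h hi
  have hM' : (4 * M : ℤ) ≠ 0 := by positivity
  have hic : i = 2 * c := mul_left_cancel₀ hM' (by push_cast at hc; linear_combination hc)
  refine ⟨x ^ (-c * (1 + 2 * M)) * y, conj_zpow_mul h _, ?_⟩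
  rw [zpow_mul_sq h hi, ← zpow_zero x]
  refine zpow_eq_zpow_of_dvd (N := 8 * M) (by rw [← hx, pow_orderOf_eq_one]) ⟨-c * (1 + M), ?_⟩
  rw [hic]
  push_cast
  ring

theorem exists_involution_conj_sub {M : ℕ} {x z : G} (hx : orderOf x = 8 * M)
    (h : z * x * z⁻¹ = x ^ (4 * M - 1 : ℤ)) (hz : z * z ∈ Subgroup.zpowers x) :
    ∃ z' : G, z' * x * z'⁻¹ = x ^ (4 * M - 1 : ℤ) ∧ z' ^ 2 = 1 := by
  obtain ⟨i, hi⟩ := hz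
  obtain ⟨c, hc⟩ := dvd_of_zpow_eq_mul_self hx h hi
  push_cast at hc
  have hic : i = 2 * M * i - 4 * M * c := by linarith
  have hic' : i = 4 * M * (M * i - 2 * M * c - c) := by linear_combination (1 + 2 * M) * hic
  generalize (M * i - 2 * M * c - c : ℤ) = l at hic'
  refine ⟨x ^ l * z, conj_zpow_mul h _, ?_⟩
  rw [zpow_mul_sq h hi, ← zpow_zero x]
  refine zpow_eq_zpow_of_dvd (N := 8 * M) (by rw [← hx, pow_orderOf_eq_one]) ⟨l, ?_⟩
  rw [hic']
  push_cast
  ring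

theorem exists_isTriple {k : ℕ} {x : G} (hx : orderOf x = 8 * 2 ^ k)
    (hn : (Subgroup.zpowers x).Normal) (hi : (Subgroup.zpowers x).index = 4)
    (hC : ∀ g : G, g * x = x * g → g ∈ Subgroup.zpowers x)
    (hsq : ∀ g : G, g * g ∈ Subgroup.zpowers x) :
    ∃ y z : G, IsTriple (2 ^ k) 0 x y z ∨ IsTriple (2 ^ k) 1 x y z := by
  obtain ⟨hcases, ⟨y₀, hy₀⟩, z₀, hz₀⟩ := exists_conj_eq_of_self_centralizing hx hn hi hC hsq
  have hpow : x ^ (8 * 2 ^ k) = 1 := by rw [← hx, pow_orderOf_eq_one]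
  have hM : 0 < 2 ^ k := by positivity
  obtain ⟨y, hy, hy2⟩ := exists_involution_conj_add hM hx hy₀ (hsq _)
  obtain ⟨z, hz, hz2⟩ := exists_involution_conj_sub hx hz₀ (hsq _)
  generalize 2 ^ k = M at *
  have hyz : (y * z) * x * (y * z)⁻¹ = x ^ (-1 : ℤ) := by
    rw [show (y * z) * x * (y * z)⁻¹ = y * (z * x * z⁻¹) * y⁻¹ by group, hz, ← conj_zpow, hy,
      ← zpow_mul]
    exact zpow_eq_zpow_of_dvd hpow ⟨2 * M, by push_cast; ring⟩
  have hgen : Subgroup.closure {x, y, z} = ⊤ := by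
    rw [Subgroup.eq_top_iff']
    intro g
    set K := Subgroup.closure {x, y, z}
    have hxK : x ∈ K := Subgroup.subset_closure (by simp)
    have hyK : y ∈ K := Subgroup.subset_closure (by simp)
    have hzK : z ∈ K := Subgroup.subset_closure (by simp)
    have key : ∀ w ∈ K, g * x * g⁻¹ = w * x * w⁻¹ → g ∈ K := fun w hw h => by
      have hmem : w⁻¹ * g ∈ Subgroup.zpowers x := hC _ <| by
        calc w⁻¹ * g * x = w⁻¹ * (g * x * g⁻¹) * g := by group
          _ = x * (w⁻¹ * g) := by rw [h]; group
      have : w⁻¹ * g ∈ K := (Subgroup.zpowers_le.2 hxK) hmem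
      simpa using mul_mem hw this
    rcases hcases g with h | h | h | h
    · exact key 1 (one_mem _) (by simpa using h)
    · exact key _ (mul_mem hyK hzK) (h.trans hyz.symm)
    · exact key _ hyK (h.trans hy.symm)
    · exact key _ hzK (h.trans hz.symm)
  obtain ⟨i, hi⟩ := hsq (y * z)
  replace hi : x ^ i = y * z * (y * z) := hi
  obtain ⟨c, hc⟩ := dvd_of_zpow_eq_mul_self hx hyz hi
  have hic : i = -(4 * M * c) := by push_cast at hc; linarith
  have hzy : z * y = y * x ^ i * z := by
    rw [hi]
    calc z * y = y⁻¹ * (y * z * (y * z)) * z⁻¹ := by group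
      _ = y * (y * z * (y * z)) * z := by rw [inv_eq_self_of_sq hy2, inv_eq_self_of_sq hz2]
  refine ⟨y, z, ?_⟩
  rcases Int.even_or_odd' c with ⟨d, hd | hd⟩
  · refine Or.inl ⟨hpow, hy2, hz2, hy, hz, ?_, hgen⟩
    rw [hzy, zpow_eq_zpow_of_dvd hpow (j := 4 * M * (0 : ℕ)) ⟨-d, by
      rw [hic, hd]; push_cast; ring⟩]
  · refine Or.inr ⟨hpow, hy2, hz2, hy, hz, ?_, hgen⟩
    rw [hzy, zpow_eq_zpow_of_dvd hpow (j := 4 * M * (1 : ℕ)) ⟨-d - 1, by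
      rw [hic, hd]; push_cast; ring⟩]

theorem classPreservingAuts_eq_innerAuts_of_commute {x w : G}
    (hi : (Subgroup.zpowers x).index = 4) (hw : w * x = x * w) (hwx : w ∉ Subgroup.zpowers x) :
    classPreservingAuts G = innerAuts G := by
  set A := Subgroup.closure {x, w}
  have hA : ∀ a ∈ A, ∀ b ∈ A, a * b = b * a := by
    have hcomm : ∀ a ∈ ({x, w} : Set G), ∀ b ∈ ({x, w} : Set G), a * b = b * a := by
      rintro _ (rfl | rfl) _ (rfl | rfl)
      exacts [rfl, hw.symm, hw, rfl]
    have := Subgroup.isMulCommutative_closure hcomm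
    exact fun a ha b hb => congrArg Subtype.val (mul_comm' (⟨a, ha⟩ : A) ⟨b, hb⟩)
  have hxA : Subgroup.zpowers x ≤ A :=
    Subgroup.zpowers_le.2 (Subgroup.subset_closure (by simp))
  have hwA : w ∈ A := Subgroup.subset_closure (by simp)
  have hmul := Subgroup.relIndex_mul_index hxA
  have hne : (Subgroup.zpowers x).relIndex A ≠ 1 := fun h =>
    hwx (Subgroup.relIndex_eq_one.1 h hwA)
  rw [hi] at hmul
  have hdvd : A.index ∣ 4 := ⟨_, by rw [← hmul, mul_comm]⟩
  have hle := Nat.le_of_dvd (by norm_num) hdvd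
  have h124 : A.index = 1 ∨ A.index = 2 := by
    generalize A.index = a at *
    generalize (Subgroup.zpowers x).relIndex A = b at *
    interval_cases a <;> omega
  rcases h124 with h | h
  · rw [Subgroup.index_eq_one] at h
    exact classPreservingAuts_eq_innerAuts_of_comm fun a b =>
      hA a (by rw [h]; trivial) b (by rw [h]; trivial)
  · exact classPreservingAuts_eq_innerAuts_of_index_two A hA h

theorem classPreservingAuts_eq_innerAuts_of_sq_notMem {x t : G} (hn : (Subgroup.zpowers x).Normal)
    (hi : (Subgroup.zpowers x).index = 4) (ht : t * t ∉ Subgroup.zpowers x) :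
    classPreservingAuts G = innerAuts G := by
  have hcard : Nat.card (G ⧸ Subgroup.zpowers x) = 4 := hi
  have : Finite (G ⧸ Subgroup.zpowers x) := Nat.finite_of_card_ne_zero (by omega)
  have hord : orderOf (t : G ⧸ Subgroup.zpowers x) = 2 ^ (1 + 1) := by
    refine orderOf_eq_prime_pow (fun h => ht ?_) ?_
    · rw [pow_one, sq, ← QuotientGroup.mk_mul, QuotientGroup.eq_one_iff] at h
      exact h
    · rw [show 2 ^ (1 + 1) = Nat.card (G ⧸ Subgroup.zpowers x) by rw [hcard]; norm_num,
        pow_card_eq_one']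
  have htop : Subgroup.zpowers (t : G ⧸ Subgroup.zpowers x) = ⊤ :=
    Subgroup.eq_top_of_card_eq _ (by rw [Nat.card_zpowers, hord, hcard]; norm_num)
  refine classPreservingAuts_eq_innerAuts_of_cyclic_quotient x t fun g => ?_
  obtain ⟨j, hj⟩ : (g : G ⧸ Subgroup.zpowers x) ∈ Subgroup.zpowers (t : G ⧸ Subgroup.zpowers x) :=
    by rw [htop]; trivial
  have hmem : g * (t ^ j)⁻¹ ∈ Subgroup.zpowers x := by
    rw [← QuotientGroup.eq_one_iff, QuotientGroup.mk_mul, QuotientGroup.mk_inv,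
      QuotientGroup.mk_zpow, ← hj]
    simp
  obtain ⟨i, hi⟩ := hmem
  refine ⟨i, j, ?_⟩
  rw [show x ^ i = g * (t ^ j)⁻¹ from hi, inv_mul_cancel_right]

end Structure

end CyclicNormalSubgroup

open CyclicNormalSubgroup in
/-- A group of order `2ⁿ`, `n > 4`, with a cyclic normal subgroup of order
`2^{n-2}` but no element of order `2^{n-1}`, has a non-inner class preserving
automorphism if and only if it is isomorphic to `G₁` or `G₂`. -/
theorem outc_ne_one_iff_iso_G1_or_G2
    {n : ℕ} (hn : 4 < n) {G : Type*} [Group G] [Finite G]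
    (hcard : Nat.card G = 2 ^ n)
    (H : Subgroup G) (hnorm : H.Normal) (hcyc : IsCyclic H)
    (hH : Nat.card H = 2 ^ (n - 2))
    (hnoelt : ∀ g : G, orderOf g ≠ 2 ^ (n - 1)) :
    classPreservingAuts G ≠ innerAuts G ↔
      (Nonempty (G ≃* PresentedGroup (relsG1 n)) ∨
       Nonempty (G ≃* PresentedGroup (relsG2 n))) := by
  obtain ⟨k, rfl⟩ : ∃ k, n = k + 5 := ⟨n - 5, by omega⟩
  have hM : 0 < 2 ^ k := by positivity
  have hcard' : Nat.card G = 32 * 2 ^ k := by rw [hcard]; ring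
  obtain ⟨⟨x, hxH⟩, hgen⟩ := hcyc.exists_generator
  have hHx : H = Subgroup.zpowers x := by
    refine le_antisymm (fun h hh => ?_) (Subgroup.zpowers_le.2 hxH)
    obtain ⟨i, hi⟩ := hgen ⟨h, hh⟩
    exact ⟨i, congrArg Subtype.val hi⟩
  subst hHx
  have hord : orderOf x = 8 * 2 ^ k := by
    rw [← Nat.card_zpowers, hH, show k + 5 - 2 = k + 3 by omega]
    ring
  have hi : (Subgroup.zpowers x).index = 4 := by
    have := (Subgroup.zpowers x).card_mul_index
    rw [Nat.card_zpowers, hord, hcard'] at this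
    exact Nat.eq_of_mul_eq_mul_left (by positivity : 0 < 8 * 2 ^ k) (by rw [this]; ring)
  constructor
  · intro hne
    have hC : ∀ g : G, g * x = x * g → g ∈ Subgroup.zpowers x := fun g hg => by
      by_contra h
      exact hne (classPreservingAuts_eq_innerAuts_of_commute hi hg h)
    have hsq : ∀ g : G, g * g ∈ Subgroup.zpowers x := fun g => by
      by_contra h
      exact hne (classPreservingAuts_eq_innerAuts_of_sq_notMem hnorm hi h)
    obtain ⟨y, z, h | h⟩ := exists_isTriple hord hnorm hi hC hsq
    · exact Or.inl (h.nonempty_mulEquiv hM hcard' (isTriple_relsG1 k) h.lift_relsG1)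
    · exact Or.inr (h.nonempty_mulEquiv hM hcard' (isTriple_relsG2 k) h.lift_relsG2)
  · rintro (⟨⟨f⟩⟩ | ⟨⟨f⟩⟩)
    · exact (isTriple_relsG1 k).classPreservingAuts_ne_innerAuts_of_mulEquiv hM hcard'
        (lift_sign_relsG1 _) f
    · exact (isTriple_relsG2 k).classPreservingAuts_ne_innerAuts_of_mulEquiv hM hcard'
        (lift_sign_relsG2 _) f
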